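/- arXiv:1205.2948 — 2 statements merged into one kernel-verified Lean document; each statement's English description precedes it below -/
import Mathlib

section
/- Assume the non-degeneracy condition P(a_1 ≤ r, b_1 ≤ r) + P(a_1 > r, b_1 > r) ≠ 0. Then for each fixed n ∈ ℤ the partial sums α_{n,k} = Σ_{j=0}^{k−1} (∏_{s=0}^{j−1} W_{n−sd}) U_{n−jd} converge in L¹ and almost surely, as k → ∞, to the random variable α_n = Σ_{j=0}^∞ (∏_{s=0}^{j−1} W_{n−sd}) U_{n−jd}; moreover Σ_{k=1}^∞ E|α_{n,k} − α_n| < ∞. -/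
open MeasureTheory ProbabilityTheory Filter Finset

/-- Currying a family of independent random variables indexed by pairs yields independent rows. -/
lemma iIndepFun_curry {Ω ι κ E : Type*} [MeasurableSpace Ω] [MeasurableSpace E]
    {P : Measure Ω} {X : ι → κ → Ω → E} (mX : ∀ i j, Measurable (X i j))
    (h : iIndepFun (fun (p : ι × κ) ω ↦ X p.1 p.2 ω) P) :
    iIndepFun (fun i ω j ↦ X i j ω) P := by
  have := h.isProbabilityMeasure
  have _ i j : IsProbabilityMeasure (P.map (X i j)) :=
    Measure.isProbabilityMeasure_map (mX i j).aemeasurable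
  have h_row (i : ι) : P.map (fun ω j ↦ X i j ω) = Measure.infinitePi fun j ↦ P.map (X i j) := by
    have hi : iIndepFun (fun j ↦ X i j) P :=
      h.precomp (g := fun j ↦ (i, j)) (Prod.mk_right_injective i)
    exact hi.map_fun_eq_infinitePi_map₀ (measurable_pi_lambda _ (mX i)).aemeasurable
  have h_all : P.map (fun ω (p : ι × κ) ↦ X p.1 p.2 ω)
      = Measure.infinitePi fun p : ι × κ ↦ P.map (X p.1 p.2) :=
    h.map_fun_eq_infinitePi_map₀ (measurable_pi_lambda _ fun p : ι × κ ↦ mX p.1 p.2).aemeasurable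
  rw [iIndepFun_iff_map_fun_eq_infinitePi_map (by fun_prop)]
  simp_rw [h_row]
  rw [← Measure.infinitePi_map_curry, ← h_all,
    Measure.map_map (by fun_prop) (measurable_pi_lambda _ fun p : ι × κ ↦ mX p.1 p.2)]
  rfl

/-- Disjoint windows of length `q + 1` of an independent sequence are independent. -/
lemma iIndepFun_windows {Ω E : Type*} [MeasurableSpace Ω] [MeasurableSpace E]
    {P : Measure Ω} {e : ℤ → Ω → E} (he : ∀ n, Measurable (e n)) (h : iIndepFun e P)
    (q d : ℕ) (hd : 0 < d) (n : ℤ) :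
    iIndepFun (fun (s : ℕ) ω (i : Fin (q + 1)) ↦
      e (n - ((s * (q + 1) : ℕ) : ℤ) * d - ((i : ℕ) : ℤ)) ω) P := by
  refine iIndepFun_curry (fun _ _ ↦ he _) ?_
  refine h.precomp (g := fun p : ℕ × Fin (q + 1) ↦
    n - ((p.1 * (q + 1) : ℕ) : ℤ) * d - ((p.2 : ℕ) : ℤ)) ?_
  rintro ⟨s, i⟩ ⟨t, j⟩ hst
  dsimp only at hst
  have hi := i.isLt
  have hj := j.isLt
  have key : s * (q + 1) * d + i = t * (q + 1) * d + j := by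
    zify
    push_cast at hst
    linarith
  have aux : ∀ {s t i j : ℕ}, i < q + 1 → s * (q + 1) * d + i = t * (q + 1) * d + j →
      t ≤ s := by
    intro s t i j hi h
    by_contra! hlt
    have h1 : (s + 1) * ((q + 1) * d) ≤ t * ((q + 1) * d) := Nat.mul_le_mul_right _ hlt
    have h2 : q + 1 ≤ (q + 1) * d := Nat.le_mul_of_pos_right _ hd
    nlinarith
  have hs : s = t := le_antisymm (aux hj key.symm) (aux hi key)
  subst hs
  simp only [Prod.mk.injEq, true_and]
  exact Fin.ext (by omega)

/-- The law of a window of an i.i.d. sequence does not depend on its position. -/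
lemma map_window_eq {Ω E : Type*} [MeasurableSpace Ω] [MeasurableSpace E]
    {P : Measure Ω} {e : ℤ → Ω → E} (he : ∀ n, Measurable (e n)) (h : iIndepFun e P)
    (hident : ∀ n, P.map (e n) = P.map (e 0)) (q : ℕ) (m : ℤ) :
    P.map (fun ω (i : Fin (q + 1)) ↦ e (m - ((i : ℕ) : ℤ)) ω)
      = Measure.pi fun _ ↦ P.map (e 0) := by
  have hm : iIndepFun (fun i : Fin (q + 1) ↦ e (m - ((i : ℕ) : ℤ))) P :=
    h.precomp (g := fun i : Fin (q + 1) ↦ m - ((i : ℕ) : ℤ)) fun i j hij ↦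
      Fin.ext (by dsimp only at hij; omega)
  rw [hm.map_fun_eq_pi_map fun i ↦ (he _).aemeasurable]
  simp_rw [hident]

section ThresholdSeries

variable {u w : ℕ → ℝ}

lemma threshold_partial_sum_mem
    (huw : ∀ j, (u j = 0 ∧ (w j = 0 ∨ w j = 1)) ∨ (u j = 1 ∧ (w j = 0 ∨ w j = -1))) (k : ℕ) :
    ∑ j ∈ range k, (∏ s ∈ range j, w s) * u j ∈ Set.Icc (0 : ℝ) 1 := by
  induction k generalizing u w with
  | zero => simp
  | succ k ih =>
    have h := ih (u := fun j ↦ u (j + 1)) (w := fun j ↦ w (j + 1)) fun j ↦ huw (j + 1)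
    rw [sum_range_succ']
    simp_rw [prod_range_succ' (fun s ↦ w s), mul_right_comm _ (w 0), ← sum_mul]
    rw [Set.mem_Icc] at h ⊢
    rcases huw 0 with ⟨h0, h1 | h1⟩ | ⟨h0, h1 | h1⟩ <;> simp only [h0, h1] <;>
      constructor <;> simp <;> linarith

lemma threshold_tsum_mem
    (huw : ∀ j, (u j = 0 ∧ (w j = 0 ∨ w j = 1)) ∨ (u j = 1 ∧ (w j = 0 ∨ w j = -1))) :
    ∑' j, (∏ s ∈ range j, w s) * u j ∈ Set.Icc (0 : ℝ) 1 := by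
  by_cases hs : Summable fun j ↦ (∏ s ∈ range j, w s) * u j
  · exact isClosed_Icc.mem_of_tendsto hs.hasSum.tendsto_sum_nat
      (Eventually.of_forall (threshold_partial_sum_mem huw))
  · simp [tsum_eq_zero_of_not_summable hs]

lemma threshold_abs_sub_le_one
    (huw : ∀ j, (u j = 0 ∧ (w j = 0 ∨ w j = 1)) ∨ (u j = 1 ∧ (w j = 0 ∨ w j = -1))) (k : ℕ) :
    |∑ j ∈ range k, (∏ s ∈ range j, w s) * u j - ∑' j, (∏ s ∈ range j, w s) * u j| ≤ 1 := by
  have h1 := threshold_partial_sum_mem huw k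
  have h2 := threshold_tsum_mem huw
  rw [abs_le]
  constructor <;> linarith [h1.1, h1.2, h2.1, h2.2]

lemma partial_sum_eq_tsum_of_eq_zero {s k : ℕ} (hsk : s < k) (hs : w s = 0) :
    ∑ j ∈ range k, (∏ s ∈ range j, w s) * u j = ∑' j, (∏ s ∈ range j, w s) * u j := by
  refine (tsum_eq_sum fun j hj ↦ ?_).symm
  have hkj : k ≤ j := by simpa using hj
  rw [prod_eq_zero (mem_range.2 (hsk.trans_le hkj)) hs, zero_mul]

end ThresholdSeries

lemma summable_pow_div {p : ℝ} (hp0 : 0 ≤ p) (hp1 : p < 1) (m : ℕ) [NeZero m] :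
    Summable fun k : ℕ ↦ p ^ (k / m) := by
  have h : Summable fun x : ℕ × Fin m ↦ p ^ x.1 * (1 : ℝ) :=
    (summable_geometric_of_lt_one hp0 hp1).mul_of_nonneg (g := fun _ : Fin m ↦ (1 : ℝ))
      (Summable.of_finite) (fun _ ↦ by positivity) (fun _ ↦ by simp)
  simpa [Function.comp_def] using (Nat.divModEquiv m).summable_iff.2 h

/-- Under the non-degeneracy condition, for each fixed `n ∈ ℤ` the
partial sums `α_{n,k} = Σ_{j=0}^{k−1} (∏_{s=0}^{j−1} W_{n−sd}) U_{n−jd}` converge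
almost surely and in `L¹`, as `k → ∞`, to
`α_n = Σ_{j=0}^∞ (∏_{s=0}^{j−1} W_{n−sd}) U_{n−jd}`; moreover
`Σ_{k=1}^∞ E|α_{n,k} − α_n| < ∞`. -/
theorem tma_partial_sums_converge
    {Ω : Type*} [MeasureSpace Ω] [IsProbabilityMeasure (ℙ : Measure Ω)]
    (e : ℤ → Ω → ℝ)
    (he : ∀ n, Measurable (e n))
    (hindep : iIndepFun e ℙ)
    (hident : ∀ n, Measure.map (e n) ℙ = Measure.map (e 0) ℙ)
    (q d : ℕ) (hq : 0 < q) (hd : 0 < d)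
    (r μ1 μ2 : ℝ) (φ ψ : ℕ → ℝ)
    (a b U W : ℤ → Ω → ℝ)
    (ha : ∀ n ω, a n ω = μ2 + e n ω + ∑ i ∈ Finset.Icc 1 q, ψ i * e (n - i) ω)
    (hb : ∀ n ω, b n ω = μ1 + e n ω + ∑ i ∈ Finset.Icc 1 q, φ i * e (n - i) ω)
    (hU : ∀ n ω, U n ω = if a n ω ≤ r then 1 else 0)
    (hW : ∀ n ω, W n ω = (if b n ω ≤ r then 1 else 0) - (if a n ω ≤ r then 1 else 0))
    (hnd : ℙ {ω | a 1 ω ≤ r ∧ b 1 ω ≤ r} + ℙ {ω | r < a 1 ω ∧ r < b 1 ω} ≠ 0)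
    (α : ℤ → Ω → ℝ)
    (hα : ∀ n ω, α n ω =
      ∑' j : ℕ, (∏ s ∈ Finset.range j, W (n - (s : ℤ) * d) ω) * U (n - (j : ℤ) * d) ω) :
    ∀ n : ℤ,
      (∀ᵐ ω ∂ℙ, Tendsto
        (fun k : ℕ => ∑ j ∈ Finset.range k,
          (∏ s ∈ Finset.range j, W (n - (s : ℤ) * d) ω) * U (n - (j : ℤ) * d) ω)
        atTop (nhds (α n ω))) ∧
      Tendsto
        (fun k : ℕ => ∫ ω, |(∑ j ∈ Finset.range k,
          (∏ s ∈ Finset.range j, W (n - (s : ℤ) * d) ω) * U (n - (j : ℤ) * d) ω)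
            - α n ω| ∂ℙ)
        atTop (nhds 0) ∧
      Summable (fun k : ℕ => ∫ ω, |(∑ j ∈ Finset.range k,
        (∏ s ∈ Finset.range j, W (n - (s : ℤ) * d) ω) * U (n - (j : ℤ) * d) ω)
          - α n ω| ∂ℙ) := by
  have mW : ∀ m, Measurable (W m) := by
    intro m
    have ma : Measurable (a m) := by
      rw [show a m = _ from funext (ha m)]
      fun_prop
    have mb : Measurable (b m) := by
      rw [show b m = _ from funext (hb m)]
      fun_prop
    rw [show W m = _ from funext (hW m)]
    exact (Measurable.ite (measurableSet_le mb measurable_const) measurable_const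
      measurable_const).sub (Measurable.ite (measurableSet_le ma measurable_const)
      measurable_const measurable_const)
  -- `W m` does not vanish iff the window of `e` at `m` lies in a fixed measurable set `B`.
  obtain ⟨B, hB, hWB⟩ : ∃ B : Set (Fin (q + 1) → ℝ), MeasurableSet B ∧
      ∀ m ω, W m ω ≠ 0 ↔ (fun i : Fin (q + 1) ↦ e (m - ((i : ℕ) : ℤ)) ω) ∈ B := by
    let L : ℝ → (ℕ → ℝ) → (Fin (q + 1) → ℝ) → ℝ := fun μ c x ↦
      μ + x 0 + ∑ i ∈ Finset.Icc 1 q, c i * x (Fin.ofNat (q + 1) i)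
    have mL : ∀ μ c, Measurable (L μ c) := fun μ c ↦ by
      simp only [L]
      fun_prop
    have hL : ∀ μ c m ω, L μ c (fun i : Fin (q + 1) ↦ e (m - ((i : ℕ) : ℤ)) ω)
        = μ + e m ω + ∑ i ∈ Finset.Icc 1 q, c i * e (m - i) ω := by
      intro μ c m ω
      simp only [L, Fin.val_zero, Nat.cast_zero, sub_zero]
      congr 1
      refine Finset.sum_congr rfl fun i hi ↦ ?_
      rw [Fin.val_ofNat, Nat.mod_eq_of_lt (by have := (Finset.mem_Icc.1 hi).2; omega)]
    refine ⟨{x | ((if L μ1 φ x ≤ r then 1 else 0) - (if L μ2 ψ x ≤ r then 1 else 0) : ℝ) ≠ 0},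
      ?_, fun m ω ↦ ?_⟩
    · have : Measurable fun x ↦
          ((if L μ1 φ x ≤ r then 1 else 0) - (if L μ2 ψ x ≤ r then 1 else 0) : ℝ) :=
        (Measurable.ite (measurableSet_le (mL _ _) measurable_const) measurable_const
          measurable_const).sub (Measurable.ite (measurableSet_le (mL _ _) measurable_const)
          measurable_const measurable_const)
      exact this (measurableSet_singleton 0).compl
    · rw [Set.mem_ofPred_eq, hL, hL, ← ha, ← hb, ← hW]
  set p : ENNReal := ℙ {ω | W 1 ω ≠ 0} with hp
  have hprob : ∀ m, ℙ ((fun ω (i : Fin (q + 1)) ↦ e (m - ((i : ℕ) : ℤ)) ω) ⁻¹' B) = p := by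
    have h1 : ∀ m, ℙ ((fun ω (i : Fin (q + 1)) ↦ e (m - ((i : ℕ) : ℤ)) ω) ⁻¹' B)
        = (Measure.pi fun _ ↦ Measure.map (e 0) ℙ) B := fun m ↦ by
      rw [← map_window_eq he hindep hident q m,
        Measure.map_apply (measurable_pi_lambda _ fun i ↦ he _) hB]
    intro m
    rw [h1, ← h1 1, hp]
    congr 1
    ext ω
    exact (hWB 1 ω).symm
  have hp_lt : p < 1 := by
    have hZ : ℙ {ω | W 1 ω = 0} ≠ 0 := by
      intro h0
      refine hnd ?_
      rw [measure_mono_null (fun ω hω ↦ ?_) h0, measure_mono_null (fun ω hω ↦ ?_) h0, add_zero]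
      · simp [hW, not_le.2 hω.1, not_le.2 hω.2]
      · simp [hW, hω.1, hω.2]
    have hc : {ω | W 1 ω ≠ 0} = (W 1 ⁻¹' {0})ᶜ := rfl
    rw [hp, hc, prob_compl_eq_one_sub (mW 1 (measurableSet_singleton 0))]
    exact ENNReal.sub_lt_self ENNReal.one_ne_top one_ne_zero hZ
  intro n
  have huw : ∀ ω (j : ℕ), (U (n - (j : ℤ) * d) ω = 0 ∧
      (W (n - (j : ℤ) * d) ω = 0 ∨ W (n - (j : ℤ) * d) ω = 1)) ∨
      (U (n - (j : ℤ) * d) ω = 1 ∧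
      (W (n - (j : ℤ) * d) ω = 0 ∨ W (n - (j : ℤ) * d) ω = -1)) := by
    intro ω j
    rw [hU, hW]
    split_ifs <;> simp
  let A : ℕ → Set Ω := fun k ↦ {ω | ∀ s < k, W (n - (s : ℤ) * d) ω ≠ 0}
  have mA : ∀ k, MeasurableSet (A k) := fun k ↦ by
    simp only [A, Set.ofPred_forall]
    exact MeasurableSet.iInter fun s ↦ MeasurableSet.iInter fun _ ↦
      mW _ (measurableSet_singleton 0).compl
  have hA : ∀ k, ℙ (A k) ≤ p ^ (k / (q + 1)) := by
    intro k
    have hind := (iIndepFun_windows he hindep q d hd n).measure_inter_preimage_eq_mul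
      (Finset.range (k / (q + 1))) (sets := fun _ ↦ B) fun _ _ ↦ hB
    simp_rw [hprob, Finset.prod_const, Finset.card_range] at hind
    rw [← hind]
    refine measure_mono fun ω hω ↦ ?_
    simp only [Set.mem_iInter, Finset.mem_range]
    intro s hs
    refine (hWB _ ω).1 (hω (s * (q + 1)) ?_)
    calc s * (q + 1) < k / (q + 1) * (q + 1) := Nat.mul_lt_mul_of_pos_right hs (Nat.succ_pos q)
      _ ≤ k := Nat.div_mul_le_self k (q + 1)
  have hbound : ∀ k, ∫ ω, |(∑ j ∈ Finset.range k,
      (∏ s ∈ Finset.range j, W (n - (s : ℤ) * d) ω) * U (n - (j : ℤ) * d) ω)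
        - α n ω| ∂ℙ ≤ p.toReal ^ (k / (q + 1)) := by
    intro k
    calc _ ≤ ∫ ω, (A k).indicator (fun _ ↦ (1 : ℝ)) ω ∂ℙ := by
          refine integral_mono_of_nonneg (Eventually.of_forall fun ω ↦ abs_nonneg _)
            ((integrable_const 1).indicator (mA k)) (Eventually.of_forall fun ω ↦ ?_)
          dsimp only
          rw [hα]
          by_cases hω : ω ∈ A k
          · rw [Set.indicator_of_mem hω]
            exact threshold_abs_sub_le_one (u := fun j : ℕ ↦ U (n - (j : ℤ) * d) ω)
              (w := fun j : ℕ ↦ W (n - (j : ℤ) * d) ω) (huw ω) k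
          · rw [Set.indicator_of_notMem hω]
            obtain ⟨s, hs, h0⟩ : ∃ s < k, W (n - (s : ℤ) * d) ω = 0 := by
              simpa [A] using hω
            rw [partial_sum_eq_tsum_of_eq_zero (u := fun j : ℕ ↦ U (n - (j : ℤ) * d) ω)
              (w := fun j : ℕ ↦ W (n - (j : ℤ) * d) ω) hs h0, sub_self, abs_zero]
      _ = (ℙ (A k)).toReal := by
          rw [integral_indicator_const _ (mA k)]
          simp [Measure.real]
      _ ≤ (p ^ (k / (q + 1))).toReal :=
          ENNReal.toReal_mono (ENNReal.pow_ne_top hp_lt.ne_top) (hA k)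
      _ = _ := ENNReal.toReal_pow _ _
  have hsum := Summable.of_nonneg_of_le (fun k ↦ integral_nonneg fun ω ↦ abs_nonneg _) hbound
    (summable_pow_div ENNReal.toReal_nonneg
      (by simpa using (ENNReal.toReal_lt_toReal hp_lt.ne_top ENNReal.one_ne_top).2 hp_lt) (q + 1))
  refine ⟨?_, hsum.tendsto_atTop_zero, hsum⟩
  have hnull : ℙ (⋂ k, A k) = 0 := by
    have hlim : Tendsto (fun k : ℕ ↦ p ^ k) atTop (nhds 0) :=
      ENNReal.tendsto_pow_atTop_nhds_zero_of_lt_one hp_lt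
    refine le_antisymm (ge_of_tendsto' hlim fun k ↦ ?_) zero_le
    calc ℙ (⋂ k, A k) ≤ ℙ (A (k * (q + 1))) := measure_mono (Set.iInter_subset _ _)
      _ ≤ p ^ (k * (q + 1) / (q + 1)) := hA _
      _ = p ^ k := by rw [Nat.mul_div_cancel _ (Nat.succ_pos q)]
  filter_upwards [measure_eq_zero_iff_ae_notMem.1 hnull] with ω hω
  obtain ⟨s, h0⟩ : ∃ s : ℕ, W (n - (s : ℤ) * d) ω = 0 := by
    by_contra! hne
    exact hω (Set.mem_iInter.2 fun k s _ ↦ hne s)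
  refine tendsto_const_nhds.congr' ?_
  filter_upwards [eventually_gt_atTop s] with k hk
  rw [hα]
  exact (partial_sum_eq_tsum_of_eq_zero (u := fun j : ℕ ↦ U (n - (j : ℤ) * d) ω)
    (w := fun j : ℕ ↦ W (n - (j : ℤ) * d) ω) hk h0).symm
end

section
/- Assume the non-degeneracy condition P(a_1 ≤ r, b_1 ≤ r) + P(a_1 > r, b_1 > r) ≠ 0. Then for every n ∈ ℤ, the product ∏_{i=0}^{k−1} W_{n−id} converges to 0 almost surely as k → ∞. -/
open MeasureTheory ProbabilityTheory Filter Finset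

/-- Grouping an independent family indexed by a product into blocks gives independent blocks. -/
lemma ProbabilityTheory.iIndepFun.curry {Ω ι κ E : Type*} [MeasurableSpace Ω] [MeasurableSpace E]
    {P : Measure Ω} [IsProbabilityMeasure P] {X : ι × κ → Ω → E} (hX : ∀ p, Measurable (X p))
    (h : iIndepFun X P) : iIndepFun (fun i ω j ↦ X (i, j) ω) P := by
  have := fun p ↦ Measure.isProbabilityMeasure_map (μ := P) (hX p).aemeasurable
  have hblock (i : ι) : P.map (fun ω j ↦ X (i, j) ω)
      = Measure.infinitePi fun j ↦ P.map (X (i, j)) :=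
    (h.precomp (Prod.mk_right_injective i)).map_fun_eq_infinitePi_map fun j ↦ hX (i, j)
  rw [iIndepFun_iff_map_fun_eq_infinitePi_map (fun i ↦ measurable_pi_lambda _ fun j ↦ hX (i, j))]
  simp_rw [hblock]
  rw [← Measure.infinitePi_map_curry (fun i j ↦ P.map (X (i, j))),
    ← h.map_fun_eq_infinitePi_map hX,
    Measure.map_map (by fun_prop) (measurable_pi_lambda _ hX)]
  rfl

/-- An i.i.d. sequence with values in `E` almost surely visits infinitely often
any measurable set that its marginal law charges. -/
lemma ProbabilityTheory.iIndepFun.ae_frequently_mem {Ω E : Type*} [MeasurableSpace Ω]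
    [MeasurableSpace E] {P : Measure Ω} {X : ℕ → Ω → E} (hX : ∀ m, Measurable (X m))
    (h : iIndepFun X P) {ν : Measure E} (hlaw : ∀ m, P.map (X m) = ν) {S : Set E}
    (hS : MeasurableSet S) (hpos : ν S ≠ 0) : ∀ᵐ ω ∂P, ∃ᶠ m in atTop, X m ω ∈ S := by
  have := h.isProbabilityMeasure
  have hmeas (m : ℕ) : MeasurableSet (X m ⁻¹' S) := hX m hS
  have hind : iIndepSet (fun m ↦ X m ⁻¹' S) P :=
    (iIndepSet_iff_meas_biInter hmeas).2 fun s ↦ h.measure_inter_preimage_eq_mul s fun _ _ ↦ hS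
  have hone : P (limsup (fun m ↦ X m ⁻¹' S) atTop) = 1 := by
    refine measure_limsup_eq_one hmeas hind ?_
    have hval (m : ℕ) : P (X m ⁻¹' S) = ν S := by rw [← hlaw m, Measure.map_apply (hX m) hS]
    simp_rw [hval]
    exact ENNReal.tsum_const_eq_top_of_ne_zero hpos
  have hae : ∀ᵐ ω ∂P, ω ∈ limsup (fun m ↦ X m ⁻¹' S) atTop :=
    (prob_compl_eq_zero_iff (MeasurableSet.measurableSet_limsup hmeas)).2 hone
  filter_upwards [hae] with ω hω
  exact mem_limsup_iff_frequently_mem.1 hω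

/-- Arithmetic progressions of blocks of length at most the common difference are disjoint. -/
lemma injective_sub_mul_sub {L : ℕ} (n K : ℤ) (hK : (L : ℤ) ≤ K) :
    Function.Injective fun p : ℕ × Fin L ↦ n - p.1 * K - (p.2 : ℕ) := by
  rintro ⟨m, j⟩ ⟨m', j'⟩ h
  have hj := j.isLt
  have hj' := j'.isLt
  simp only at h
  have hm : m = m' := by
    rcases lt_trichotomy (m : ℤ) m' with hlt | heq | hlt
    · nlinarith [mul_le_mul_of_nonneg_right (Int.add_one_le_iff.2 hlt) (by lia : 0 ≤ K)]
    · exact_mod_cast heq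
    · nlinarith [mul_le_mul_of_nonneg_right (Int.add_one_le_iff.2 hlt) (by lia : 0 ≤ K)]
  subst hm
  exact Prod.ext rfl (Fin.ext (by lia))

/-- Under the non-degeneracy condition, for every `n ∈ ℤ` the product
`∏_{i=0}^{k−1} W_{n−id}` converges to `0` almost surely as `k → ∞`. -/
theorem tma_product_tendsto_zero
    {Ω : Type*} [MeasureSpace Ω] [IsProbabilityMeasure (ℙ : Measure Ω)]
    (e : ℤ → Ω → ℝ)
    (he : ∀ n, Measurable (e n))
    (hindep : iIndepFun e ℙ)
    (hident : ∀ n, Measure.map (e n) ℙ = Measure.map (e 0) ℙ)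
    (q d : ℕ) (hq : 0 < q) (hd : 0 < d)
    (r μ1 μ2 : ℝ) (φ ψ : ℕ → ℝ)
    (a b W : ℤ → Ω → ℝ)
    (ha : ∀ n ω, a n ω = μ2 + e n ω + ∑ i ∈ Finset.Icc 1 q, ψ i * e (n - i) ω)
    (hb : ∀ n ω, b n ω = μ1 + e n ω + ∑ i ∈ Finset.Icc 1 q, φ i * e (n - i) ω)
    (hW : ∀ n ω, W n ω = (if b n ω ≤ r then 1 else 0) - (if a n ω ≤ r then 1 else 0))
    (hnd : ℙ {ω | a 1 ω ≤ r ∧ b 1 ω ≤ r} + ℙ {ω | r < a 1 ω ∧ r < b 1 ω} ≠ 0) :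
    ∀ n : ℤ, ∀ᵐ ω ∂ℙ,
      Tendsto (fun k : ℕ => ∏ i ∈ Finset.range k, W (n - (i : ℤ) * d) ω)
        atTop (nhds 0) := by
  intro n
  let lin (μ : ℝ) (c : ℕ → ℝ) (v : Fin (q + 1) → ℝ) : ℝ :=
    μ + v 0 + ∑ i ∈ Finset.Icc 1 q, c i * v (Fin.ofNat (q + 1) i)
  have hlin_meas (μ : ℝ) (c : ℕ → ℝ) : Measurable (lin μ c) := by fun_prop
  let block (s : ℤ) (ω : Ω) (j : Fin (q + 1)) : ℝ := e (s - (j : ℕ)) ω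
  have hlin (μ : ℝ) (c : ℕ → ℝ) (s : ℤ) (ω : Ω) :
      lin μ c (block s ω) = μ + e s ω + ∑ i ∈ Finset.Icc 1 q, c i * e (s - i) ω := by
    simp only [lin, block]
    congr 1
    · simp
    · refine Finset.sum_congr rfl fun i hi ↦ ?_
      rw [Fin.val_ofNat, Nat.mod_eq_of_lt (by simp at hi; lia)]
  have ha' (s : ℤ) (ω : Ω) : a s ω = lin μ2 ψ (block s ω) := by rw [ha, hlin]
  have hb' (s : ℤ) (ω : Ω) : b s ω = lin μ1 φ (block s ω) := by rw [hb, hlin]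
  let S₁ : Set (Fin (q + 1) → ℝ) := {v | lin μ2 ψ v ≤ r ∧ lin μ1 φ v ≤ r}
  let S₂ : Set (Fin (q + 1) → ℝ) := {v | r < lin μ2 ψ v ∧ r < lin μ1 φ v}
  have hS : MeasurableSet (S₁ ∪ S₂) :=
    ((measurableSet_le (hlin_meas _ _) measurable_const).inter
      (measurableSet_le (hlin_meas _ _) measurable_const)).union
    ((measurableSet_lt measurable_const (hlin_meas _ _)).inter
      (measurableSet_lt measurable_const (hlin_meas _ _)))
  have hblock_meas (s : ℤ) : Measurable (block s) := measurable_pi_lambda _ fun j ↦ he _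
  have hlaw (s : ℤ) :
      Measure.map (block s) ℙ = Measure.pi fun _ : Fin (q + 1) ↦ Measure.map (e 0) ℙ := by
    have hinj : Function.Injective fun j : Fin (q + 1) ↦ s - ((j : ℕ) : ℤ) :=
      fun j j' h ↦ Fin.ext (by simp only at h; lia)
    rw [(hindep.precomp hinj).map_fun_eq_pi_map fun j ↦ (he _).aemeasurable]
    simp_rw [hident (s - _)]
  have hpos : (Measure.pi fun _ : Fin (q + 1) ↦ Measure.map (e 0) ℙ) (S₁ ∪ S₂) ≠ 0 := by
    rw [← hlaw 1, Measure.map_apply (hblock_meas 1) hS]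
    intro h0
    apply hnd
    rw [add_eq_zero]
    simp_rw [ha', hb']
    exact ⟨measure_mono_null (fun ω hω ↦ Or.inl hω) h0,
      measure_mono_null (fun ω hω ↦ Or.inr hω) h0⟩
  have hW_zero (s : ℤ) (ω : Ω) (h : block s ω ∈ S₁ ∪ S₂) : W s ω = 0 := by
    rw [hW, ha', hb']
    rcases h with ⟨h₁, h₂⟩ | ⟨h₁, h₂⟩
    · simp [h₁, h₂]
    · simp [h₁.not_ge, h₂.not_ge]
  have hinj := injective_sub_mul_sub (L := q + 1) n ((q + 1 : ℕ) * d)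
    (le_mul_of_one_le_right (by positivity) (by exact_mod_cast hd))
  have hblocks : iIndepFun (fun m : ℕ ↦ block (n - m * ((q + 1 : ℕ) * d))) ℙ :=
    (hindep.precomp hinj).curry fun p ↦ he _
  filter_upwards [hblocks.ae_frequently_mem (fun m ↦ hblock_meas _) (fun m ↦ hlaw _) hS hpos]
    with ω hω
  obtain ⟨m, hm⟩ := hω.exists
  refine tendsto_const_nhds.congr' ?_
  filter_upwards [eventually_gt_atTop (m * (q + 1))] with k hk
  refine (Finset.prod_eq_zero (Finset.mem_range.2 hk) ?_).symm
  rw [← hW_zero _ ω hm]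
  congr 1
  push_cast
  ring
end
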